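/- Let e ≥ 0 and u > 2^e be integers with gcd(u, 2^m − 1) = 1 and gcd(u − 2^e, 2^m − 1) = 1, and define F : F_{2^n} → F_{2^n} by F(x) = x^{2^e}·(Tr_{2^n/2^m}(x))^{u−2^e}. Let W_{H_1}(ω) = Σ_{x∈K_m} (−1)^{Tr_{2^m/2}(x^u)+Tr_{2^m/2}(ωx)} for ω ∈ K_m, and suppose there is a positive integer A such that the set of values of W_{H_1} on K_m is exactly {0, A, −A}. Let R = #{x ∈ K_m : (x+1)^u + x^u + 1 = 0}. Then A² = 2^m·R, the maximum of |W_{F_a}(ω)| over a ≠ 0 and ω equals 2^m·A (so N_F = 2^{n−1} − 2^{m−1}·A); moreover R ≥ 2, and if m is even and 3 does not divide u then R ≥ 4. -/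

import Mathlib

open scoped Classical BigOperators

noncomputable section

/-- The finite field with `2^k` elements. -/
abbrev GF (k : ℕ) := GaloisField 2 k

noncomputable instance (k : ℕ) : Fintype (GF k) := Fintype.ofFinite _

/-- The absolute trace `Tr_{2^k/2}`, viewed as an element of `GF k`
(its values lie in the prime field `{0,1}`). -/
def atr (k : ℕ) (x : GF k) : GF k := ∑ j ∈ Finset.range k, x ^ 2 ^ j

/-- `(-1)^b` for `b ∈ {0,1} ⊆ GF k`. -/
def chi (k : ℕ) (x : GF k) : ℤ := if x = 0 then 1 else -1

/-- The Walsh transform of a Boolean-valued function `f` on `GF k`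
(`f` takes values in the prime field `{0,1}`). -/
def walsh (k : ℕ) (f : GF k → GF k) (ω : GF k) : ℤ :=
  ∑ x : GF k, chi k (f x + atr k (ω * x))

/-- The trace `Tr_{2^m/2}` of the subfield `K_m ⊆ GF (2*m)`, viewed inside `GF (2*m)`. -/
def trKm (m : ℕ) (x : GF (2*m)) : GF (2*m) := ∑ j ∈ Finset.range m, x ^ 2 ^ j

/-- The subfield `K_m = {x : x^(2^m) = x}` of `GF (2*m)`, as a finset. -/
def Km (m : ℕ) : Finset (GF (2*m)) := Finset.univ.filter (fun x => x ^ 2 ^ m = x)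

/-- `max_{a ≠ 0, ω} |W_{F_a}(ω)|` for a vectorial function `F` on `GF (2*m)`. -/
def maxAbsW (m : ℕ) (F : GF (2*m) → GF (2*m)) : ℕ :=
  Finset.sup ((Finset.univ.filter (fun a : GF (2*m) => a ≠ 0)) ×ˢ (Finset.univ : Finset (GF (2*m))))
    (fun p => (walsh (2*m) (fun x => atr (2*m) (p.1 * F x)) p.2).natAbs)

/-- The nonlinearity `N_F = 2^(n-1) - (1/2) max_{a ≠ 0, ω} |W_{F_a}(ω)|`, `n = 2m`. -/
def nlin (m : ℕ) (F : GF (2*m) → GF (2*m)) : ℚ :=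
  2 ^ (2*m - 1) - (maxAbsW m F : ℚ) / 2


section FiniteFieldCharTwo

variable {K : Type*} [Field K] [Fintype K]

/-- Raising to a power coprime to `#K - 1` permutes a finite field `K`. -/
theorem bijective_pow_of_coprime_card_sub_one {u : ℕ} (hu : 0 < u)
    (h : Nat.gcd u (Fintype.card K - 1) = 1) : Function.Bijective (fun x : K => x ^ u) := by
  refine Finite.injective_iff_bijective.mp fun x y hxy => ?_
  change x ^ u = y ^ u at hxy
  rcases eq_or_ne y 0 with rfl | hy
  · rw [zero_pow hu.ne'] at hxy
    exact pow_eq_zero_iff hu.ne' |>.mp hxy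
  have hx : x ≠ 0 := by
    rintro rfl
    rw [zero_pow hu.ne'] at hxy
    exact hy (pow_eq_zero_iff hu.ne' |>.mp hxy.symm)
  have h1 : (x / y) ^ u = 1 := by rw [div_pow, hxy, div_self (pow_ne_zero _ hy)]
  have h2 : (x / y) ^ (Fintype.card K - 1) = 1 :=
    FiniteField.pow_card_sub_one_eq_one _ (div_ne_zero hx hy)
  have h3 := pow_gcd_eq_one.mpr ⟨h1, h2⟩
  rw [h, pow_one] at h3
  exact (div_eq_one_iff_eq hy).mp h3

variable {ψ : AddChar K ℤ}

/-- Every component of a power permutation has the same Walsh spectrum. -/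
theorem exists_walsh_component_eq {u : ℕ} (hu : 0 < u)
    (h : Nat.gcd u (Fintype.card K - 1) = 1) {a : K} (ha : a ≠ 0) (ω : K) :
    ∃ ω' : K, ∑ x, ψ (a * x ^ u + ω * x) = ∑ x, ψ (x ^ u + ω' * x) := by
  obtain ⟨b, rfl⟩ := (bijective_pow_of_coprime_card_sub_one hu h).surjective a
  have hb : b ≠ 0 := by
    rintro rfl
    exact ha (zero_pow hu.ne')
  refine ⟨ω / b, ?_⟩
  rw [← (mulLeft_bijective₀ b hb).sum_comp fun x => ψ (x ^ u + ω / b * x)]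
  refine Finset.sum_congr rfl fun x _ => ?_
  rw [mul_pow]
  congr 2
  field_simp

variable [DecidableEq K]

theorem sum_addChar_mul (hψ : ψ.IsPrimitive) (b : K) :
    ∑ x, ψ (b * x) = if b = 0 then (Fintype.card K : ℤ) else 0 := by
  have := AddChar.sum_mulShift b hψ
  simp only [mul_comm b]
  rw [this]
  split_ifs <;> simp

/-- The sum of all values of a Walsh transform. -/
theorem sum_walsh_eq (hψ : ψ.IsPrimitive) (f : K → K) :
    ∑ ω, ∑ x, ψ (f x + ω * x) = Fintype.card K * ψ (f 0) := by
  rw [Finset.sum_comm]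
  have : ∀ x, ∑ ω, ψ (f x + ω * x) = if x = 0 then (Fintype.card K : ℤ) * ψ (f 0) else 0 := by
    intro x
    simp only [AddChar.map_add_eq_mul, ← Finset.mul_sum, mul_comm _ x, sum_addChar_mul hψ]
    split_ifs with h
    · rw [h, mul_comm]
    · simp
  simp [this]

variable [CharP K 2]

/-- The third moment of a Walsh transform in characteristic two. -/
theorem sum_walsh_cube_eq (hψ : ψ.IsPrimitive) (f : K → K) :
    ∑ ω, (∑ x, ψ (f x + ω * x)) ^ 3
      = Fintype.card K * ∑ x, ∑ y, ψ (f x + f y + f (x + y)) := by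
  have h1 : ∀ ω, (∑ x, ψ (f x + ω * x)) ^ 3
      = ∑ x, ∑ y, ∑ z, ψ (f x + f y + f z) * ψ ((x + y + z) * ω) := by
    intro ω
    rw [pow_three, Finset.sum_mul_sum, Finset.sum_mul_sum]
    refine Finset.sum_congr rfl fun x _ => ?_
    refine Finset.sum_congr rfl fun y _ => ?_
    rw [Finset.mul_sum]
    refine Finset.sum_congr rfl fun z _ => ?_
    simp only [← AddChar.map_add_eq_mul]
    congr 1
    ring
  have h2 : ∀ x y z : K, ∑ ω, ψ (f x + f y + f z) * ψ ((x + y + z) * ω)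
      = if z = x + y then (Fintype.card K : ℤ) * ψ (f x + f y + f (x + y)) else 0 := by
    intro x y z
    rw [← Finset.mul_sum, sum_addChar_mul hψ]
    by_cases hz : z = x + y
    · subst hz
      simp [CharTwo.add_self_eq_zero, mul_comm]
    · have : x + y + z ≠ 0 := fun h => hz (CharTwo.add_eq_zero.mp h).symm
      simp [hz, this]
  calc ∑ ω, (∑ x, ψ (f x + ω * x)) ^ 3
      = ∑ x, ∑ y, ∑ z, ∑ ω, ψ (f x + f y + f z) * ψ ((x + y + z) * ω) := by
        simp only [h1]
        rw [Finset.sum_comm]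
        refine Finset.sum_congr rfl fun x _ => ?_
        rw [Finset.sum_comm]
        refine Finset.sum_congr rfl fun y _ => ?_
        rw [Finset.sum_comm]
    _ = _ := by simp [h2, Finset.mul_sum]

/-- The third moment of a power permutation counts the zeros of `(x + 1) ^ u + x ^ u + 1`. -/
theorem sum_sum_addChar_pow (hψ : ψ.IsPrimitive) {u : ℕ} (hu : 0 < u)
    (h : Nat.gcd u (Fintype.card K - 1) = 1) :
    ∑ x : K, ∑ y : K, ψ (x ^ u + y ^ u + (x + y) ^ u)
      = Fintype.card K * (Finset.univ.filter fun x : K => (x + 1) ^ u + x ^ u + 1 = 0).card := by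
  have hx0 : ∑ y : K, ψ ((0 : K) ^ u + y ^ u + (0 + y) ^ u) = Fintype.card K := by
    simp [zero_pow hu.ne', CharTwo.add_self_eq_zero]
  have hx : ∀ x : K, x ≠ 0 → ∑ y : K, ψ (x ^ u + y ^ u + (x + y) ^ u)
      = ∑ t : K, ψ (((t + 1) ^ u + t ^ u + 1) * x ^ u) := by
    intro x hx
    rw [← (mulLeft_bijective₀ x hx).sum_comp]
    refine Finset.sum_congr rfl fun t _ => ?_
    congr 1
    rw [show x + x * t = (t + 1) * x by ring, mul_pow, mul_pow]
    ring
  have hsplit : ∀ g : K → ℤ, ∑ x, g x = g 0 + ∑ x ∈ Finset.univ.erase (0 : K), g x :=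
    fun g => (Finset.add_sum_erase _ g (Finset.mem_univ 0)).symm
  have hall : ∑ x : K, ∑ t : K, ψ (((t + 1) ^ u + t ^ u + 1) * x ^ u)
      = Fintype.card K * (Finset.univ.filter fun x : K => (x + 1) ^ u + x ^ u + 1 = 0).card := by
    rw [Finset.sum_comm]
    have (t : K) : ∑ x : K, ψ (((t + 1) ^ u + t ^ u + 1) * x ^ u)
        = if (t + 1) ^ u + t ^ u + 1 = 0 then (Fintype.card K : ℤ) else 0 := by
      rw [← sum_addChar_mul hψ]
      exact (bijective_pow_of_coprime_card_sub_one hu h).sum_comp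
        (fun x => ψ (((t + 1) ^ u + t ^ u + 1) * x))
    simp only [this, ← Finset.sum_filter, Finset.sum_const, nsmul_eq_mul]
    ring
  rw [← hall, hsplit, hx0, hsplit fun x => ∑ t : K, ψ (((t + 1) ^ u + t ^ u + 1) * x ^ u)]
  congr 1
  · simp [zero_pow hu.ne']
  · exact Finset.sum_congr rfl fun x hx' => hx x (Finset.ne_of_mem_erase hx')

/-- A power permutation whose Walsh transform takes values in `{0, A, -A}`. -/
theorem sq_eq_card_mul_of_walsh_three_valued (hψ : ψ.IsPrimitive) {u : ℕ} (hu : 0 < u)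
    (h : Nat.gcd u (Fintype.card K - 1) = 1) {A : ℤ}
    (hA : ∀ ω : K, ∑ x, ψ (x ^ u + ω * x) = 0 ∨ ∑ x, ψ (x ^ u + ω * x) = A ∨
      ∑ x, ψ (x ^ u + ω * x) = -A) :
    A ^ 2 = Fintype.card K *
      (Finset.univ.filter fun x : K => (x + 1) ^ u + x ^ u + 1 = 0).card := by
  have h1 := sum_walsh_cube_eq hψ (fun x : K => x ^ u)
  have h2 := sum_walsh_eq hψ (fun x : K => x ^ u)
  have h3 : ∀ ω : K, (∑ x, ψ (x ^ u + ω * x)) ^ 3 = A ^ 2 * ∑ x, ψ (x ^ u + ω * x) := by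
    intro ω
    rcases hA ω with h | h | h <;> rw [h] <;> ring
  simp only [zero_pow hu.ne', AddChar.map_zero_eq_one, mul_one] at h2
  simp only [h3, ← Finset.mul_sum, h2, sum_sum_addChar_pow hψ hu h] at h1
  have hc : (Fintype.card K : ℤ) ≠ 0 := by exact_mod_cast Fintype.card_ne_zero
  refine mul_left_cancel₀ hc ?_
  rw [← h1]
  ring

/-- An affine sum twisted by a power of Frobenius, for a Frobenius-invariant character. -/
theorem sum_addChar_frobenius (hψ : ψ.IsPrimitive) (hfrob : ∀ z, ψ (z ^ 2) = ψ z) (e : ℕ)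
    (b w : K) :
    ∑ y, ψ (b * y ^ 2 ^ e + w * y) = if b = w ^ 2 ^ e then (Fintype.card K : ℤ) else 0 := by
  have hit : ∀ (k : ℕ) (z : K), ψ (z ^ 2 ^ k) = ψ z := by
    intro k
    induction k with
    | zero => simp
    | succ k ih => intro z; rw [pow_succ, pow_mul, hfrob, ih]
  have hbij : Function.Bijective fun y : K => y ^ 2 ^ e :=
    Finite.injective_iff_bijective.mp (iterateFrobenius_inj K 2 e)
  have : ∀ y : K, ψ (b * y ^ 2 ^ e + w * y) = ψ ((b + w ^ 2 ^ e) * y ^ 2 ^ e) := by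
    intro y
    rw [AddChar.map_add_eq_mul, ← hit e (w * y), ← AddChar.map_add_eq_mul]
    congr 1
    ring
  simp only [this]
  rw [hbij.sum_comp fun y => ψ ((b + w ^ 2 ^ e) * y), sum_addChar_mul hψ]
  simp only [CharTwo.add_eq_zero]

theorem two_le_card_zeros {u : ℕ} (hu : 0 < u) :
    2 ≤ (Finset.univ.filter fun x : K => (x + 1) ^ u + x ^ u + 1 = 0).card := by
  rw [← Finset.card_pair (zero_ne_one (α := K))]
  refine Finset.card_le_card fun x hx => ?_
  simp only [Finset.mem_insert, Finset.mem_singleton] at hx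
  rcases hx with rfl | rfl <;> simp [CharTwo.add_self_eq_zero, zero_pow hu.ne']

theorem four_le_card_zeros {u : ℕ} (h3 : 3 ∣ Fintype.card K - 1) (hu3 : ¬ 3 ∣ u) :
    4 ≤ (Finset.univ.filter fun x : K => (x + 1) ^ u + x ^ u + 1 = 0).card := by
  have hu : u ≠ 0 := by
    rintro rfl
    exact hu3 (dvd_zero 3)
  have : Fact (Nat.Prime 3) := ⟨Nat.prime_three⟩
  obtain ⟨g, hg⟩ := exists_prime_orderOf_dvd_card (G := Kˣ) 3 (by rwa [Fintype.card_units])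
  set w : K := (g : K) with hw
  have hord : orderOf w = 3 := by rw [hw, orderOf_units, hg]
  have hroot : ∀ v : K, v ^ 3 = 1 → v ≠ 1 → v ^ 2 + v + 1 = 0 := by
    intro v hv hv1
    refine (mul_eq_zero.mp (?_ : (v - 1) * (v ^ 2 + v + 1) = 0)).resolve_left
      (sub_ne_zero.mpr hv1)
    linear_combination hv
  have hw3 : w ^ 3 = 1 := hord ▸ pow_orderOf_eq_one w
  have hw1 : w ≠ 1 := by
    intro h
    rw [h, orderOf_one] at hord
    omega
  have hw0 : w ≠ 0 := g.ne_zero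
  have hww : w + 1 = w ^ 2 := by
    have := hroot w hw3 hw1
    rw [add_assoc] at this
    exact (CharTwo.add_eq_zero.mp this).symm
  have hwu : (w + 1) ^ u + w ^ u + 1 = 0 := by
    rw [hww, ← pow_mul, mul_comm, pow_mul]
    refine hroot _ (by rw [← pow_mul, mul_comm, pow_mul, hw3, one_pow]) fun h => hu3 ?_
    rw [← hord]
    exact orderOf_dvd_of_pow_eq_one h
  have hww1 : w + 1 + 1 = w := by rw [add_assoc, CharTwo.add_self_eq_zero, add_zero]
  have hcard : ({0, 1, w, w + 1} : Finset K).card = 4 := by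
    have h1 : w + 1 ≠ 0 := fun h => hw1 (CharTwo.add_eq_zero.mp h)
    rw [Finset.card_insert_of_notMem, Finset.card_insert_of_notMem, Finset.card_pair] <;>
      simp [hw0, hw0.symm, hw1.symm, h1.symm]
  rw [← hcard]
  refine Finset.card_le_card fun x hx => ?_
  simp only [Finset.mem_insert, Finset.mem_singleton] at hx
  rcases hx with rfl | rfl | rfl | rfl
  · simp [zero_pow hu, CharTwo.add_self_eq_zero]
  · simp [zero_pow hu, CharTwo.add_self_eq_zero]
  · simpa using hwu
  · simp only [Finset.mem_filter, Finset.mem_univ, true_and, hww1]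
    rw [add_comm (w ^ u)]
    exact hwu

end FiniteFieldCharTwo

section QuadraticExtension

variable {m : ℕ}

theorem card_GF {k : ℕ} (hk : k ≠ 0) : Fintype.card (GF k) = 2 ^ k := by
  rw [← Nat.card_eq_fintype_card, GaloisField.card 2 k hk]

theorem pow_two_pow_two_mul (hm : 1 ≤ m) (x : GF (2 * m)) : (x ^ 2 ^ m) ^ 2 ^ m = x := by
  rw [← pow_mul, ← pow_add, ← two_mul, ← card_GF (by omega), FiniteField.pow_card]

/-- `Km m` as a subfield of `GF (2 * m)`. -/
def subfieldKm (m : ℕ) : Subfield (GF (2 * m)) where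
  carrier := {x | x ^ 2 ^ m = x}
  mul_mem' {a b} ha hb := by
    simp only [Set.mem_ofPred_eq] at ha hb ⊢
    rw [mul_pow, ha, hb]
  one_mem' := one_pow _
  add_mem' {a b} ha hb := by
    simp only [Set.mem_ofPred_eq] at ha hb ⊢
    rw [add_pow_char_pow, ha, hb]
  zero_mem' := zero_pow (by positivity)
  neg_mem' {a} ha := by
    simpa only [CharTwo.neg_eq] using ha
  inv_mem' a ha := by
    simp only [Set.mem_ofPred_eq] at ha ⊢
    change a⁻¹ ^ 2 ^ m = a⁻¹
    rw [inv_pow, show a ^ 2 ^ m = a from ha]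

theorem mem_subfieldKm {x : GF (2 * m)} : x ∈ subfieldKm m ↔ x ^ 2 ^ m = x := Iff.rfl

theorem mem_Km_iff (x : GF (2 * m)) : x ∈ Km m ↔ x ∈ subfieldKm m := by
  simp [Km, mem_subfieldKm]

theorem sum_Km {M : Type*} [AddCommMonoid M] (g : GF (2 * m) → M) :
    ∑ x ∈ Km m, g x = ∑ x : subfieldKm m, g x :=
  Finset.sum_subtype (Km m) mem_Km_iff g

theorem card_filter_Km (u : ℕ) :
    ((Km m).filter fun x => (x + 1) ^ u + x ^ u + 1 = 0).card
      = (Finset.univ.filter fun x : subfieldKm m => (x + 1) ^ u + x ^ u + 1 = 0).card := by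
  rw [Finset.card_filter, Finset.card_filter, sum_Km]
  refine Finset.sum_congr rfl fun x _ => ?_
  congr 1
  rw [← Subtype.coe_inj]
  simp

/-- The relative trace from `GF (2 * m)` to `Km m`. -/
def relTrace (hm : 1 ≤ m) : GF (2 * m) →ₗ[subfieldKm m] subfieldKm m where
  toFun x := ⟨x + x ^ 2 ^ m, by
    rw [mem_subfieldKm, add_pow_char_pow, pow_two_pow_two_mul hm, add_comm]⟩
  map_add' x y := by
    ext
    simp only [add_pow_char_pow, Subfield.coe_add]
    ring
  map_smul' c x := by
    ext
    have hc : (c : GF (2 * m)) ^ 2 ^ m = c := c.2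
    simp only [Subfield.smul_def, smul_eq_mul, mul_pow, hc, RingHom.id_apply, Subfield.coe_mul]
    ring

theorem coe_relTrace (hm : 1 ≤ m) (x : GF (2 * m)) :
    (relTrace hm x : GF (2 * m)) = x + x ^ 2 ^ m := rfl

theorem relTrace_coe_mul (hm : 1 ≤ m) (c : subfieldKm m) (x : GF (2 * m)) :
    relTrace hm (c * x) = c * relTrace hm x := (relTrace hm).map_smul c x

theorem relTrace_coe (hm : 1 ≤ m) (c : subfieldKm m) : relTrace hm (c : GF (2 * m)) = 0 := by
  ext
  have hc : (c : GF (2 * m)) ^ 2 ^ m = c := c.2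
  rw [coe_relTrace, hc, CharTwo.add_self_eq_zero, Subfield.coe_zero]

theorem relTrace_eq_zero_iff (hm : 1 ≤ m) (x : GF (2 * m)) :
    relTrace hm x = 0 ↔ x ∈ subfieldKm m := by
  rw [← Subtype.coe_inj, coe_relTrace, Subfield.coe_zero, CharTwo.add_eq_zero, mem_subfieldKm,
    eq_comm]

theorem relTrace_pow (hm : 1 ≤ m) (x : GF (2 * m)) (e : ℕ) :
    relTrace hm (x ^ 2 ^ e) = relTrace hm x ^ 2 ^ e := by
  ext
  rw [SubmonoidClass.coe_pow, coe_relTrace, coe_relTrace, add_pow_char_pow, pow_right_comm]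

theorem exists_relTrace_eq_one (hm : 1 ≤ m) : ∃ θ : GF (2 * m), relTrace hm θ = 1 := by
  obtain ⟨x, hx⟩ : ∃ x : GF (2 * m), relTrace hm x ≠ 0 := by
    by_contra! hall
    have h1 : 1 < 2 ^ m := Nat.one_lt_two_pow (by omega)
    have hcard := Polynomial.card_le_degree_of_subset_roots
      (p := (Polynomial.X ^ 2 ^ m - Polynomial.X : Polynomial (GF (2 * m))))
      (Z := Finset.univ) fun x _ => by
        rw [Polynomial.mem_roots (FiniteField.X_pow_card_sub_X_ne_zero _ h1)]
        have := mem_subfieldKm.mp ((relTrace_eq_zero_iff hm x).mp (hall x))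
        simp [this]
    rw [FiniteField.X_pow_card_sub_X_natDegree_eq _ h1, Finset.card_univ,
      card_GF (by omega)] at hcard
    exact absurd hcard (not_le.mpr (Nat.pow_lt_pow_right one_lt_two (by omega)))
  refine ⟨((relTrace hm x)⁻¹ : subfieldKm m) * x, ?_⟩
  rw [relTrace_coe_mul, inv_mul_cancel₀ hx]

/-- The decomposition `x = t * θ + y` with `t, y ∈ Km m`, where `θ` has relative trace one. -/
def decomposition (hm : 1 ≤ m) {θ : GF (2 * m)} (hθ : relTrace hm θ = 1) :
    subfieldKm m × subfieldKm m ≃ GF (2 * m) where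
  toFun p := p.1 * θ + p.2
  invFun x := (relTrace hm x, ⟨x + relTrace hm x * θ, by
    rw [← relTrace_eq_zero_iff hm, map_add, relTrace_coe_mul, hθ, mul_one,
      CharTwo.add_self_eq_zero]⟩)
  left_inv p := by
    have h : relTrace hm (p.1 * θ + p.2) = p.1 := by
      rw [map_add, relTrace_coe_mul, hθ, relTrace_coe, mul_one, add_zero]
    ext
    · simp only [h]
    · simp only [h]
      rw [add_right_comm, CharTwo.add_self_eq_zero, zero_add]
  right_inv x := by
    simp only
    rw [add_left_comm, CharTwo.add_self_eq_zero, add_zero]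

theorem card_subfieldKm (hm : 1 ≤ m) : Fintype.card (subfieldKm m) = 2 ^ m := by
  obtain ⟨θ, hθ⟩ := exists_relTrace_eq_one hm
  have h := Fintype.card_congr (decomposition hm hθ)
  rw [Fintype.card_prod, card_GF (by omega), ← sq, pow_mul'] at h
  exact Nat.pow_left_injective two_ne_zero h

theorem trKm_add (x y : GF (2 * m)) : trKm m (x + y) = trKm m x + trKm m y := by
  simp only [trKm, add_pow_char_pow, Finset.sum_add_distrib]

theorem trKm_sq {x : GF (2 * m)} (hx : x ∈ subfieldKm m) : trKm m (x ^ 2) = trKm m x := by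
  have h1 := Finset.sum_range_succ (fun j => x ^ 2 ^ j) m
  rw [Finset.sum_range_succ', mem_subfieldKm.mp hx, pow_zero, pow_one] at h1
  rw [trKm, trKm, ← add_right_cancel h1]
  refine Finset.sum_congr rfl fun j _ => ?_
  rw [← pow_mul, pow_succ']

theorem trKm_eq_zero_or_one {x : GF (2 * m)} (hx : x ∈ subfieldKm m) :
    trKm m x = 0 ∨ trKm m x = 1 := by
  have h : trKm m x ^ 2 = trKm m x := by
    conv_rhs => rw [← trKm_sq hx]
    rw [trKm, trKm, CharTwo.sum_sq]
    refine Finset.sum_congr rfl fun j _ => ?_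
    rw [pow_right_comm]
  exact IsIdempotentElem.iff_eq_zero_or_one.mp ((sq _).symm.trans h)

theorem atr_eq_trKm_relTrace (hm : 1 ≤ m) (x : GF (2 * m)) :
    atr (2 * m) x = trKm m (relTrace hm x) := by
  have h : Finset.range (2 * m) = Finset.range (m + m) := congrArg _ (two_mul m)
  rw [coe_relTrace, trKm_add, atr, h, Finset.sum_range_add, trKm, trKm]
  congr 1
  refine Finset.sum_congr rfl fun j _ => ?_
  rw [← pow_mul, pow_add]

theorem chi_add {k : ℕ} {x y : GF k} (hx : x = 0 ∨ x = 1) (hy : y = 0 ∨ y = 1) :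
    chi k (x + y) = chi k x * chi k y := by
  rcases hx with rfl | rfl <;> rcases hy with rfl | rfl <;>
    simp [chi, CharTwo.add_self_eq_zero]

/-- The canonical additive character of `Km m`. -/
def psiKm (m : ℕ) : AddChar (subfieldKm m) ℤ where
  toFun x := chi (2 * m) (trKm m x)
  map_zero_eq_one' := by simp [chi, trKm]
  map_add_eq_mul' x y := by
    rw [Subfield.coe_add, trKm_add,
      chi_add (trKm_eq_zero_or_one x.2) (trKm_eq_zero_or_one y.2)]

theorem psiKm_apply (x : subfieldKm m) : psiKm m x = chi (2 * m) (trKm m x) := rfl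

theorem psiKm_sq (x : subfieldKm m) : psiKm m (x ^ 2) = psiKm m x := by
  rw [psiKm_apply, psiKm_apply, SubmonoidClass.coe_pow, trKm_sq x.2]

theorem psiKm_eq_one_or_neg_one (x : subfieldKm m) : psiKm m x = 1 ∨ psiKm m x = -1 := by
  rw [psiKm_apply, chi]
  split_ifs <;> simp

theorem psiKm_isPrimitive (hm : 1 ≤ m) : (psiKm m).IsPrimitive := by
  refine AddChar.IsPrimitive.of_ne_one fun hone => ?_
  let P : Polynomial (GF (2 * m)) := ∑ j ∈ Finset.range m, Polynomial.X ^ 2 ^ j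
  have hdeg : P.natDegree ≤ 2 ^ (m - 1) := by
    refine Polynomial.natDegree_sum_le_of_forall_le _ _ fun j hj => ?_
    rw [Polynomial.natDegree_X_pow]
    exact Nat.pow_le_pow_right two_pos (by have := Finset.mem_range.mp hj; omega)
  have hP : P ≠ 0 := by
    intro h
    have hc : P.coeff 1 = 1 := by
      simp only [P, Polynomial.finsetSum_coeff, Polynomial.coeff_X_pow]
      rw [Finset.sum_eq_single 0]
      · simp
      · intro j _ hj
        have : 1 < 2 ^ j := Nat.one_lt_two_pow hj
        simp [this.ne]
      · intro h0
        exact absurd (Finset.mem_range.mpr hm) h0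
    rw [h, Polynomial.coeff_zero] at hc
    exact zero_ne_one hc
  have hroots : Km m ⊆ P.roots.toFinset := by
    intro x hx
    rw [Multiset.mem_toFinset, Polynomial.mem_roots hP]
    have h := DFunLike.congr_fun hone (⟨x, (mem_Km_iff x).mp hx⟩ : subfieldKm m)
    rw [psiKm_apply, AddChar.one_apply, chi] at h
    have h0 : trKm m x = 0 := by
      by_contra h0
      rw [if_neg h0] at h
      omega
    simpa [P, Polynomial.IsRoot, Polynomial.eval_finsetSum, trKm] using h0
  have hcard := (Finset.card_le_card hroots).trans
    ((Multiset.toFinset_card_le _).trans ((Polynomial.card_roots' P).trans hdeg))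
  rw [Finset.card_eq_sum_ones, sum_Km, ← Finset.card_eq_sum_ones, Finset.card_univ,
    card_subfieldKm hm] at hcard
  exact absurd hcard (not_le.mpr (Nat.pow_lt_pow_right one_lt_two (by omega)))

theorem sum_Km_chi_eq (u : ℕ) (ω : subfieldKm m) :
    ∑ x ∈ Km m, chi (2 * m) (trKm m (x ^ u) + trKm m (ω * x))
      = ∑ x, psiKm m (x ^ u + ω * x) := by
  rw [sum_Km]
  refine Finset.sum_congr rfl fun x _ => ?_
  rw [psiKm_apply, ← trKm_add]
  simp

/-- The Walsh transform of a component of `x ^ 2 ^ e * (x + x ^ 2 ^ m) ^ v`, reduced to a sum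
over `Km m`. -/
theorem walsh_component_eq (hm : 1 ≤ m) {θ : GF (2 * m)} (hθ : relTrace hm θ = 1) (e v : ℕ)
    (a ω : GF (2 * m)) :
    walsh (2 * m) (fun x => atr (2 * m) (a * (x ^ 2 ^ e * (x + x ^ 2 ^ m) ^ v))) ω
      = ∑ t : subfieldKm m, psiKm m (relTrace hm (a * θ ^ 2 ^ e) * t ^ (2 ^ e + v)
          + relTrace hm (ω * θ) * t)
        * if relTrace hm a * t ^ v = relTrace hm ω ^ 2 ^ e then (2 : ℤ) ^ m else 0 := by
  rw [walsh, ← (decomposition hm hθ).sum_comp, Fintype.sum_prod_type]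
  refine Finset.sum_congr rfl fun t _ => ?_
  have hcard : (2 : ℤ) ^ m = (Fintype.card (subfieldKm m) : ℤ) := by
    rw [card_subfieldKm hm]; push_cast; rfl
  rw [hcard, ← sum_addChar_frobenius (psiKm_isPrimitive hm) psiKm_sq, Finset.mul_sum]
  refine Finset.sum_congr rfl fun y _ => ?_
  rw [← AddChar.map_add_eq_mul, psiKm_apply, atr_eq_trKm_relTrace hm, atr_eq_trKm_relTrace hm,
    ← trKm_add, ← Subfield.coe_add, ← map_add]
  congr 3
  have hx : (decomposition hm hθ) (t, y) = t * θ + y := rfl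
  have hT : (t * θ + y) + (t * θ + y) ^ 2 ^ m = (t : GF (2 * m)) := by
    rw [← coe_relTrace hm, map_add, relTrace_coe_mul, hθ, relTrace_coe, mul_one, add_zero]
  rw [hx, hT, add_pow_char_pow, mul_pow]
  have hsplit : a * (((t : GF (2 * m)) ^ 2 ^ e * θ ^ 2 ^ e + (y : GF (2 * m)) ^ 2 ^ e) * t ^ v)
        + ω * (t * θ + y)
      = ((t ^ (2 ^ e + v) : subfieldKm m) : GF (2 * m)) * (a * θ ^ 2 ^ e)
        + (t : GF (2 * m)) * (ω * θ)
        + (((t ^ v * y ^ 2 ^ e : subfieldKm m) : GF (2 * m)) * a + (y : GF (2 * m)) * ω) := by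
    push_cast
    ring
  rw [hsplit, map_add, map_add, map_add, relTrace_coe_mul, relTrace_coe_mul, relTrace_coe_mul,
    relTrace_coe_mul]
  ring

/-- On `Km m` the Walsh transform of a component with coefficient in `Km m` is a multiple of the
Walsh transform of a power function on `Km m`. -/
theorem walsh_component_of_mem (hm : 1 ≤ m) (e v : ℕ) (a ω : subfieldKm m) :
    walsh (2 * m) (fun x => atr (2 * m) (a * (x ^ 2 ^ e * (x + x ^ 2 ^ m) ^ v))) ω
      = 2 ^ m * ∑ t, psiKm m (a * t ^ (2 ^ e + v) + ω * t) := by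
  obtain ⟨θ, hθ⟩ := exists_relTrace_eq_one hm
  rw [walsh_component_eq hm hθ, Finset.mul_sum]
  refine Finset.sum_congr rfl fun t _ => ?_
  rw [relTrace_coe_mul, relTrace_coe_mul, relTrace_pow, hθ, relTrace_coe, relTrace_coe, one_pow,
    mul_one, mul_one, zero_mul, zero_pow (by positivity), if_pos rfl, mul_comm]

theorem walsh_component_of_mem_of_notMem (hm : 1 ≤ m) (e v : ℕ) (a : subfieldKm m)
    {ω : GF (2 * m)} (hω : ω ∉ subfieldKm m) :
    walsh (2 * m) (fun x => atr (2 * m) (a * (x ^ 2 ^ e * (x + x ^ 2 ^ m) ^ v))) ω = 0 := by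
  obtain ⟨θ, hθ⟩ := exists_relTrace_eq_one hm
  rw [walsh_component_eq hm hθ]
  refine Finset.sum_eq_zero fun t _ => ?_
  rw [relTrace_coe, zero_mul, if_neg, mul_zero]
  exact (pow_ne_zero _ (mt (relTrace_eq_zero_iff hm ω).mp hω)).symm

theorem natAbs_walsh_component_of_notMem (hm : 1 ≤ m) (e : ℕ) {v : ℕ} (hv : 0 < v)
    (hg : Nat.gcd v (2 ^ m - 1) = 1) {a : GF (2 * m)} (ha : a ∉ subfieldKm m)
    (ω : GF (2 * m)) :
    (walsh (2 * m) (fun x => atr (2 * m) (a * (x ^ 2 ^ e * (x + x ^ 2 ^ m) ^ v))) ω).natAbs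
      = 2 ^ m := by
  obtain ⟨θ, hθ⟩ := exists_relTrace_eq_one hm
  have hb : relTrace hm a ≠ 0 := mt (relTrace_eq_zero_iff hm a).mp ha
  have hbij : Function.Bijective fun t : subfieldKm m => t ^ v :=
    bijective_pow_of_coprime_card_sub_one hv (by rwa [card_subfieldKm hm])
  obtain ⟨t₀, ht₀⟩ := hbij.surjective (relTrace hm ω ^ 2 ^ e / relTrace hm a)
  have ht : ∀ t, relTrace hm a * t ^ v = relTrace hm ω ^ 2 ^ e ↔ t = t₀ := by
    intro t
    rw [← hbij.injective.eq_iff (a := t)]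
    simp only at ht₀ ⊢
    rw [ht₀, eq_div_iff hb, mul_comm (t ^ v)]
  rw [walsh_component_eq hm hθ]
  simp only [ht, mul_ite, mul_zero, Finset.sum_ite_eq', Finset.mem_univ, if_true]
  rcases psiKm_eq_one_or_neg_one (relTrace hm (a * θ ^ 2 ^ e) * t₀ ^ (2 ^ e + v)
    + relTrace hm (ω * θ) * t₀) with h | h <;> simp [h, Int.natAbs_pow]

end QuadraticExtension

/-- three-valued Walsh transform case: if the value set of `W_{H_1}`
(`H_1(x) = Tr_{2^m/2}(x^u)` on `K_m`) is exactly `{0, A, −A}` with `A > 0`, and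
`R = #{x ∈ K_m : (x+1)^u + x^u + 1 = 0}`, then `A² = 2^m·R`,
`max_{a≠0,ω}|W_{F_a}(ω)| = 2^m·A` (so `N_F = 2^(n−1) − 2^(m−1)·A`), `R ≥ 2`, and
if `m` is even and `3 ∤ u` then `R ≥ 4`. -/
theorem stmt3 (m : ℕ) (hm : 1 ≤ m) (e u : ℕ) (hu : 2 ^ e < u)
    (hg1 : Nat.gcd u (2 ^ m - 1) = 1)
    (hg2 : Nat.gcd (u - 2 ^ e) (2 ^ m - 1) = 1)
    (A : ℤ) (hA : 0 < A)
    (hval : (Km m).image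
        (fun ω => ∑ x ∈ Km m, chi (2*m) (trKm m (x ^ u) + trKm m (ω * x)))
      = ({0, A, -A} : Finset ℤ)) :
    A ^ 2 = 2 ^ m *
        (((Km m).filter (fun x => (x + 1) ^ u + x ^ u + 1 = 0)).card : ℤ) ∧
    ((maxAbsW m (fun x : GF (2*m) => x ^ 2 ^ e * (x + x ^ 2 ^ m) ^ (u - 2 ^ e)) : ℤ)
        = 2 ^ m * A) ∧
    nlin m (fun x : GF (2*m) => x ^ 2 ^ e * (x + x ^ 2 ^ m) ^ (u - 2 ^ e))
        = 2 ^ (2*m - 1) - 2 ^ (m - 1) * (A : ℚ) ∧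
    2 ≤ ((Km m).filter (fun x => (x + 1) ^ u + x ^ u + 1 = 0)).card ∧
    (Even m → ¬ (3 ∣ u) →
      4 ≤ ((Km m).filter (fun x => (x + 1) ^ u + x ^ u + 1 = 0)).card) := by
  have hu0 : 0 < u := lt_of_le_of_lt (Nat.zero_le _) hu
  have huv : 2 ^ e + (u - 2 ^ e) = u := by omega
  have hcard := card_subfieldKm hm
  have hgK : Nat.gcd u (Fintype.card (subfieldKm m) - 1) = 1 := by rwa [hcard]
  have hvals (ω : subfieldKm m) : ∑ x, psiKm m (x ^ u + ω * x) = 0 ∨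
      ∑ x, psiKm m (x ^ u + ω * x) = A ∨ ∑ x, psiKm m (x ^ u + ω * x) = -A := by
    have h := Finset.mem_image_of_mem
      (fun ω => ∑ x ∈ Km m, chi (2*m) (trKm m (x ^ u) + trKm m (ω * x)))
      ((mem_Km_iff (ω : GF (2 * m))).mpr ω.2)
    rw [hval] at h
    simpa only [sum_Km_chi_eq, Finset.mem_insert, Finset.mem_singleton] using h
  have habs (ω : subfieldKm m) : (∑ x, psiKm m (x ^ u + ω * x)).natAbs ≤ A.natAbs := by
    rcases hvals ω with h | h | h <;> rw [h] <;> simp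
  have hmax : maxAbsW m (fun x : GF (2*m) => x ^ 2 ^ e * (x + x ^ 2 ^ m) ^ (u - 2 ^ e))
      = 2 ^ m * A.natAbs := by
    apply le_antisymm
    · refine Finset.sup_le fun p hp => ?_
      obtain ⟨a, ω⟩ := p
      have ha : a ≠ 0 := by simpa using hp
      by_cases haK : a ∈ subfieldKm m
      · lift a to subfieldKm m using haK
        by_cases hωK : ω ∈ subfieldKm m
        · lift ω to subfieldKm m using hωK
          have ha' : a ≠ 0 := by
            rintro rfl
            exact ha rfl
          obtain ⟨ω', hω'⟩ := exists_walsh_component_eq (ψ := psiKm m) hu0 hgK ha' ω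
          simp only [walsh_component_of_mem hm, huv, hω', Int.natAbs_mul, Int.natAbs_pow]
          exact Nat.mul_le_mul_left _ (habs ω')
        · simp only [walsh_component_of_mem_of_notMem hm _ _ _ hωK]
          exact Nat.zero_le _
      · simp only [natAbs_walsh_component_of_notMem hm e (Nat.sub_pos_of_lt hu) hg2 haK]
        exact Nat.le_mul_of_pos_right _ (by omega)
    · have hmem : A ∈ ({0, A, -A} : Finset ℤ) := by simp
      rw [← hval] at hmem
      obtain ⟨ω, hω, hωA⟩ := Finset.mem_image.mp hmem
      lift ω to subfieldKm m using (mem_Km_iff ω).mp hω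
      simp only [sum_Km_chi_eq] at hωA
      have hw := walsh_component_of_mem hm e (u - 2 ^ e) 1 ω
      simp only [huv, one_mul, hωA, Subfield.coe_one] at hw
      have hle := Finset.le_sup
        (s := (Finset.univ.filter (fun a : GF (2*m) => a ≠ 0)) ×ˢ
          (Finset.univ : Finset (GF (2*m))))
        (f := fun p => (walsh (2*m) (fun x => atr (2*m)
          (p.1 * (x ^ 2 ^ e * (x + x ^ 2 ^ m) ^ (u - 2 ^ e)))) p.2).natAbs)
        (b := ((1 : GF (2 * m)), (ω : GF (2 * m)))) (by simp)
      simp only [one_mul, hw, Int.natAbs_mul, Int.natAbs_pow] at hle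
      exact hle
  have hmaxZ : (maxAbsW m (fun x : GF (2*m) =>
      x ^ 2 ^ e * (x + x ^ 2 ^ m) ^ (u - 2 ^ e)) : ℤ) = 2 ^ m * A := by
    rw [hmax]
    push_cast
    rw [abs_of_pos hA]
  refine ⟨?_, hmaxZ, ?_, ?_, ?_⟩
  · rw [card_filter_Km, sq_eq_card_mul_of_walsh_three_valued (psiKm_isPrimitive hm) hu0 hgK hvals,
      hcard]
    push_cast
    rfl
  · have hq : (maxAbsW m (fun x : GF (2*m) =>
        x ^ 2 ^ e * (x + x ^ 2 ^ m) ^ (u - 2 ^ e)) : ℚ) = 2 ^ m * A := by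
      exact_mod_cast hmaxZ
    obtain ⟨k, rfl⟩ : ∃ k, m = k + 1 := ⟨m - 1, by omega⟩
    rw [nlin, hq, Nat.add_sub_cancel, pow_succ]
    ring
  · rw [card_filter_Km]
    exact two_le_card_zeros hu0
  · rintro ⟨k, rfl⟩ h3
    rw [card_filter_Km]
    refine four_le_card_zeros ?_ h3
    rw [hcard, ← two_mul, pow_mul]
    have h := Nat.sub_dvd_pow_sub_pow (2 ^ 2) 1 k
    rw [one_pow] at h
    exact h
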